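/- Let A ∈ ℝ^{n×n}, B ∈ ℝ^{n×m}, let F ∈ ℝ^{N×N}, let ε > 0 and h > 0, and let {ν_1, …, ν_M} ⊂ ℂ be a finite point set whose convex hull (in ℂ viewed as a real vector space) contains every complex eigenvalue of F. Suppose there exist common real symmetric positive definite n×n matrices P̄, S̄, R̄, a symmetric invertible matrix Ȳ ∈ ℝ^{n×n}, and a matrix X̄ ∈ ℝ^{m×n} such that for every l = 1, …, M the 3n×3n complex block matrix with blocks N₁₁ = ȲAᵀ + AȲ + S̄ − R̄, N₁₂ = −ν_l B X̄ + R̄, N₁₃ = P̄ − Ȳᵀ + ε Ȳ Aᵀ, N₂₂ = −(S̄ + R̄), N₂₃ = −ν_l* ε X̄ᵀ Bᵀ, N₃₃ = −2ε Ȳ + h² R̄ (remaining blocks determined by Hermitian symmetry) is negative definite. Then with the state-feedback gain K = X̄ Ȳ⁻¹, for every delay τ ∈ [0, h], every solution δ : ℝ → ℝ^{Nn} of the global error dynamics δ̇(t) = (I_N ⊗ A) δ(t) − (F ⊗ BK) δ(t−τ) tends to 0 as t → ∞. -/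

import Mathlib

open Matrix Filter
open scoped Kronecker

/-- A complex square matrix is negative definite: Hermitian with
`zᴴ M z < 0` for every nonzero complex vector `z`. -/
def Matrix.NegDefC {k : Type*} [Fintype k] (M : Matrix k k ℂ) : Prop :=
  M.IsHermitian ∧ ∀ z : k → ℂ, z ≠ 0 → (star z ⬝ᵥ M.mulVec z).re < 0

/-- The `3n × 3n` Hermitian block matrix determined by its upper-triangular blocks. -/
def Matrix.herm3 {n : ℕ} (M11 M12 M13 M22 M23 M33 : Matrix (Fin n) (Fin n) ℂ) :
    Matrix (Fin 3 × Fin n) (Fin 3 × Fin n) ℂ :=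
  fun p q => ![![M11, M12, M13], ![M12ᴴ, M22, M23], ![M13ᴴ, M23ᴴ, M33]] p.1 q.1 p.2 q.2

/-- The design LMI matrix (24) of the paper (descriptor method). -/
noncomputable def designLmiMatrix {n m : ℕ}
    (A : Matrix (Fin n) (Fin n) ℝ) (B : Matrix (Fin n) (Fin m) ℝ)
    (ν : ℂ) (ε h : ℝ)
    (Pb Sb Rb Yb : Matrix (Fin n) (Fin n) ℝ) (Xb : Matrix (Fin m) (Fin n) ℝ) :
    Matrix (Fin 3 × Fin n) (Fin 3 × Fin n) ℂ :=
  let Ac := A.map (Complex.ofReal)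
  let Bc := B.map (Complex.ofReal)
  let Pc := Pb.map (Complex.ofReal)
  let Sc := Sb.map (Complex.ofReal)
  let Rc := Rb.map (Complex.ofReal)
  let Yc := Yb.map (Complex.ofReal)
  let Xc := Xb.map (Complex.ofReal)
  Matrix.herm3
    (Yc * Acᵀ + Ac * Yc + Sc - Rc)                       -- N₁₁
    (-(ν • (Bc * Xc)) + Rc)                              -- N₁₂
    (Pc - Ycᵀ + (ε : ℂ) • (Yc * Acᵀ))                    -- N₁₃
    (-(Sc + Rc))                                         -- N₂₂
    (-((starRingEnd ℂ ν) • (ε : ℂ) • (Xcᵀ * Bcᵀ)))       -- N₂₃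
    (-((2 * ε : ℝ) : ℂ) • Yc + ((h ^ 2 : ℝ) : ℂ) • Rc)   -- N₃₃


/-- Real bilinear form of a real matrix on complex vectors. -/
noncomputable def qf {n : ℕ} (G : Matrix (Fin n) (Fin n) ℝ) (a b : Fin n → ℂ) : ℝ :=
  (star a ⬝ᵥ (G.map Complex.ofReal) *ᵥ b).re

/-- squared norm -/
noncomputable def nsq {n : ℕ} (a : Fin n → ℂ) : ℝ := ∑ i, Complex.normSq (a i)

noncomputable def rip {n : ℕ} (a b : Fin n → ℂ) : ℝ := (star a ⬝ᵥ b).re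

lemma nsq_nonneg {n : ℕ} (a : Fin n → ℂ) : 0 ≤ nsq a :=
  Finset.sum_nonneg fun i _ => Complex.normSq_nonneg _

lemma rip_self {n : ℕ} (a : Fin n → ℂ) : rip a a = nsq a := by
  simp [rip, nsq, dotProduct, Complex.normSq_apply]

lemma rip_young {n : ℕ} (a b : Fin n → ℂ) {r : ℝ} (hr : 0 < r) :
    |2 * rip a b| ≤ r * nsq a + r⁻¹ * nsq b := by
  have key : ∀ s : ℝ, s = 1 ∨ s = -1 → s * (2 * rip a b) ≤ r * nsq a + r⁻¹ * nsq b := by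
    intro s hs
    simp only [rip, nsq, dotProduct, Complex.re_sum, Finset.mul_sum, ← Finset.sum_add_distrib]
    apply Finset.sum_le_sum
    intro i _
    simp only [Pi.star_apply, RCLike.star_def, Complex.mul_re, Complex.conj_re, Complex.conj_im,
      Complex.normSq_apply]
    have h1 : ∀ x y : ℝ, s * (2 * (x * y)) ≤ r * (x * x) + r⁻¹ * (y * y) := by
      intro x y
      have : r * (x * x) + r⁻¹ * (y * y) - s * (2 * (x * y)) = r⁻¹ * (r * x - s * y)^2 := by
        rcases hs with rfl | rfl <;> field_simp <;> ring
      have h2 : 0 ≤ r⁻¹ * (r * x - s * y)^2 := by positivity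
      linarith
    have := h1 (a i).re (b i).re
    have := h1 (a i).im (b i).im
    nlinarith
  rw [abs_le]
  have h1 := key 1 (Or.inl rfl)
  have h2 := key (-1) (Or.inr rfl)
  constructor <;> linarith

lemma qf_add_right {n : ℕ} (G : Matrix (Fin n) (Fin n) ℝ) (a b c : Fin n → ℂ) :
    qf G a (b + c) = qf G a b + qf G a c := by
  simp [qf, mulVec_add, dotProduct_add]

lemma qf_add_left {n : ℕ} (G : Matrix (Fin n) (Fin n) ℝ) (a b c : Fin n → ℂ) :
    qf G (a + b) c = qf G a c + qf G b c := by
  simp [qf, add_dotProduct]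

lemma qf_smul_right {n : ℕ} (G : Matrix (Fin n) (Fin n) ℝ) (r : ℝ) (a b : Fin n → ℂ) :
    qf G a (r • b) = r * qf G a b := by
  simp [qf, mulVec_smul, dotProduct_smul]

lemma qf_smul_left {n : ℕ} (G : Matrix (Fin n) (Fin n) ℝ) (r : ℝ) (a b : Fin n → ℂ) :
    qf G (r • a) b = r * qf G a b := by
  simp [qf, smul_dotProduct]

lemma qf_sub_right {n : ℕ} (G : Matrix (Fin n) (Fin n) ℝ) (a b c : Fin n → ℂ) :
    qf G a (b - c) = qf G a b - qf G a c := by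
  simp [qf, mulVec_sub, dotProduct_sub]

lemma qf_sub_left {n : ℕ} (G : Matrix (Fin n) (Fin n) ℝ) (a b c : Fin n → ℂ) :
    qf G (a - b) c = qf G a c - qf G b c := by
  simp [qf, sub_dotProduct]

lemma qf_eq {n : ℕ} (G : Matrix (Fin n) (Fin n) ℝ) (a b : Fin n → ℂ) :
    qf G a b = (fun i => (a i).re) ⬝ᵥ G *ᵥ (fun i => (b i).re)
      + (fun i => (a i).im) ⬝ᵥ G *ᵥ (fun i => (b i).im) := by
  simp [qf, dotProduct, mulVec, Finset.mul_sum, ← Finset.sum_add_distrib, Complex.re_sum,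
    Complex.im_sum]

lemma qf_symm {n : ℕ} {G : Matrix (Fin n) (Fin n) ℝ} (hG : G.IsSymm) (a b : Fin n → ℂ) :
    qf G a b = qf G b a := by
  have : ∀ x y : Fin n → ℝ, x ⬝ᵥ G *ᵥ y = y ⬝ᵥ G *ᵥ x := by
    intro x y
    rw [dotProduct_mulVec, ← mulVec_transpose, hG.eq, dotProduct_comm]
  rw [qf_eq, qf_eq, this, this (fun i => (a i).im)]

lemma qf_nonneg {n : ℕ} {G : Matrix (Fin n) (Fin n) ℝ} (hG : G.PosDef) (a : Fin n → ℂ) :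
    0 ≤ qf G a a := by
  have h := hG.posSemidef.dotProduct_mulVec_nonneg
  rw [qf_eq]
  exact add_nonneg (by simpa using h _) (by simpa using h _)

lemma posDef_isSymm {n : ℕ} {G : Matrix (Fin n) (Fin n) ℝ} (hG : G.PosDef) : G.IsSymm := by
  have := hG.isHermitian
  simpa [Matrix.IsHermitian, Matrix.IsSymm] using this

lemma qf_hasDerivAt {n : ℕ} (G : Matrix (Fin n) (Fin n) ℝ) {x y : ℝ → Fin n → ℂ}
    {x' y' : Fin n → ℂ} {t : ℝ} (hx : HasDerivAt x x' t) (hy : HasDerivAt y y' t) :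
    HasDerivAt (fun s => qf G (x s) (y s)) (qf G x' (y t) + qf G (x t) y') t := by
  have hx1 := hasDerivAt_pi.1 hx
  have hy1 := hasDerivAt_pi.1 hy
  have hc : HasDerivAt (fun s => ∑ i, ∑ j, (star (x s i)) * ((G i j : ℂ) * y s j))
      (∑ i, ∑ j, (star (x' i) * ((G i j : ℂ) * y t j) + star (x t i) * ((G i j : ℂ) * y' j))) t := by
    apply HasDerivAt.fun_sum; intro i _
    apply HasDerivAt.fun_sum; intro j _
    exact ((hx1 i).star).mul ((hy1 j).const_mul _)
  have := (Complex.reCLM.hasFDerivAt.comp_hasDerivAt t hc)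
  have e : (fun s => qf G (x s) (y s)) =
      (Complex.reCLM ∘ fun s => ∑ i, ∑ j, (star (x s i)) * ((G i j : ℂ) * y s j)) := by
    funext s; simp [qf, dotProduct, mulVec, Finset.mul_sum]
  rw [e]
  refine this.congr_deriv ?_
  simp [qf, dotProduct, mulVec, Finset.mul_sum, Finset.sum_add_distrib]

/-- stacking -/
def stk {n : ℕ} (a b c : Fin n → ℂ) : Fin 3 × Fin n → ℂ := fun p => ![a, b, c] p.1 p.2

lemma herm3_form {n : ℕ} (M11 M12 M13 M22 M23 M33 : Matrix (Fin n) (Fin n) ℂ)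
    (a b c : Fin n → ℂ) :
    (star (stk a b c) ⬝ᵥ (Matrix.herm3 M11 M12 M13 M22 M23 M33) *ᵥ (stk a b c)).re =
      (star a ⬝ᵥ M11 *ᵥ a).re + (star b ⬝ᵥ M22 *ᵥ b).re + (star c ⬝ᵥ M33 *ᵥ c).re
      + 2 * (star a ⬝ᵥ M12 *ᵥ b).re + 2 * (star a ⬝ᵥ M13 *ᵥ c).re
      + 2 * (star b ⬝ᵥ M23 *ᵥ c).re := by
  have hH : ∀ (M : Matrix (Fin n) (Fin n) ℂ) (x y : Fin n → ℂ),
      (star y ⬝ᵥ Mᴴ *ᵥ x).re = (star x ⬝ᵥ M *ᵥ y).re := by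
    intro M x y
    have : star y ⬝ᵥ Mᴴ *ᵥ x = star (star x ⬝ᵥ M *ᵥ y) := by
      rw [← star_dotProduct_star, star_star, star_mulVec, dotProduct_mulVec]
    rw [this]; simp
  have e : star (stk a b c) ⬝ᵥ (Matrix.herm3 M11 M12 M13 M22 M23 M33) *ᵥ (stk a b c) =
      (star a ⬝ᵥ M11 *ᵥ a + star a ⬝ᵥ M12 *ᵥ b + star a ⬝ᵥ M13 *ᵥ c)
      + (star b ⬝ᵥ M12ᴴ *ᵥ a + star b ⬝ᵥ M22 *ᵥ b + star b ⬝ᵥ M23 *ᵥ c)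
      + (star c ⬝ᵥ M13ᴴ *ᵥ a + star c ⬝ᵥ M23ᴴ *ᵥ b + star c ⬝ᵥ M33 *ᵥ c) := by
    simp only [dotProduct, mulVec, Fintype.sum_prod_type, Fin.sum_univ_three, stk, Matrix.herm3,
      Pi.star_apply, ← Finset.sum_add_distrib, ← mul_add, cons_val]
  rw [e]
  simp only [Complex.add_re, hH]
  ring

lemma design_form {n m : ℕ}
    (A : Matrix (Fin n) (Fin n) ℝ) (B : Matrix (Fin n) (Fin m) ℝ)
    (ν : ℂ) (ε h : ℝ)
    (Pb Sb Rb Yb : Matrix (Fin n) (Fin n) ℝ) (Xb : Matrix (Fin m) (Fin n) ℝ)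
    (hR : Rb.IsSymm) (hY : Yb.IsSymm) (a b c : Fin n → ℂ) :
    (star (stk a b c) ⬝ᵥ (designLmiMatrix A B ν ε h Pb Sb Rb Yb Xb) *ᵥ (stk a b c)).re =
      2 * qf Pb a c + qf Sb a a - qf Sb b b + h ^ 2 * qf Rb c c - qf Rb (a - b) (a - b)
      + 2 * rip (a + ε • c) ((A * Yb).map Complex.ofReal *ᵥ a
          - ν • ((B * Xb).map Complex.ofReal *ᵥ b) - Yb.map Complex.ofReal *ᵥ c) := by
  have hsw : ∀ (M : Matrix (Fin n) (Fin n) ℝ) (x y : Fin n → ℂ),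
      qf Mᵀ x y = qf M y x := by
    intro M x y
    have : ∀ x y : Fin n → ℝ, x ⬝ᵥ Mᵀ *ᵥ y = y ⬝ᵥ M *ᵥ x := by
      intro x y
      rw [mulVec_transpose, dotProduct_comm, ← dotProduct_mulVec]
    rw [qf_eq, qf_eq, this, this (fun i => (x i).im)]
  have hsw2 : ∀ (M : Matrix (Fin n) (Fin n) ℝ) (x y : Fin n → ℂ),
      (starRingEnd ℂ ν * (star x ⬝ᵥ Mᵀ.map Complex.ofReal *ᵥ y)).re
        = (ν * (star y ⬝ᵥ M.map Complex.ofReal *ᵥ x)).re := by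
    intro M x y
    have : star x ⬝ᵥ Mᵀ.map Complex.ofReal *ᵥ y = star (star y ⬝ᵥ M.map Complex.ofReal *ᵥ x) := by
      simp only [dotProduct, mulVec, star_sum, Finset.mul_sum, star_mul', star_star]
      rw [Finset.sum_comm]
      refine Finset.sum_congr rfl fun i _ => Finset.sum_congr rfl fun j _ => ?_
      simp; ring
    rw [this]
    simp
  have mm : ∀ {p q r : ℕ} (U : Matrix (Fin p) (Fin q) ℝ) (V : Matrix (Fin q) (Fin r) ℝ),
      U.map Complex.ofReal * V.map Complex.ofReal = (U * V).map Complex.ofReal := by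
    intro p q r U V
    exact (Matrix.map_mul (f := Complex.ofRealHom)).symm
  have mt : ∀ {p q : ℕ} (U : Matrix (Fin p) (Fin q) ℝ),
      (U.map Complex.ofReal)ᵀ = Uᵀ.map Complex.ofReal := fun U => rfl
  unfold designLmiMatrix
  simp only [herm3_form, mt, mm]
  have e1 : Yb * Aᵀ = (A * Yb)ᵀ := by rw [transpose_mul, hY.eq]
  have e2 : Xbᵀ * Bᵀ = (B * Xb)ᵀ := by rw [transpose_mul]
  rw [e1, e2, hY.eq]
  have s1 := hsw (A * Yb) a a
  have s2 := hsw (A * Yb) a c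
  have s3 := hsw2 (B * Xb) b c
  have s4 := qf_symm hR a b
  simp only [qf_sub_left, qf_sub_right]
  simp only [qf_sub_left, qf_sub_right, qf, rip, add_mulVec, sub_mulVec, neg_mulVec, smul_mulVec,
    dotProduct_add, dotProduct_sub, dotProduct_neg, dotProduct_smul, add_dotProduct, star_add,
    star_smul, smul_dotProduct, Complex.add_re, Complex.sub_re, Complex.neg_re, smul_eq_mul,
    Complex.real_smul, Complex.re_ofReal_mul, mul_add, star_trivial] at s1 s2 s3 s4 ⊢
  rw [mul_left_comm ν (ε : ℂ), Complex.re_ofReal_mul]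
  rw [mul_left_comm (starRingEnd ℂ ν) (ε : ℂ), Complex.re_ofReal_mul, s1, s2, s3, s4]
  rw [show -((2 * ε : ℝ) : ℂ) = ((-(2 * ε) : ℝ) : ℂ) by push_cast; ring, Complex.re_ofReal_mul]
  ring

lemma stk_eq_zero {n : ℕ} {a b c : Fin n → ℂ} (h : stk a b c = 0) : a = 0 ∧ b = 0 ∧ c = 0 := by
  refine ⟨?_, ?_, ?_⟩ <;> ext i
  · simpa [stk] using congrFun h (0, i)
  · simpa [stk] using congrFun h (1, i)
  · simpa [stk] using congrFun h (2, i)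

lemma stk_surj {n : ℕ} (z : Fin 3 × Fin n → ℂ) :
    z = stk (fun i => z (0, i)) (fun i => z (1, i)) (fun i => z (2, i)) := by
  ext ⟨p, i⟩
  fin_cases p <;> simp [stk]

lemma form_neg_hull {n m M : ℕ}
    (A : Matrix (Fin n) (Fin n) ℝ) (B : Matrix (Fin n) (Fin m) ℝ)
    (ε h : ℝ) (νs : Fin M → ℂ)
    (Pb Sb Rb Yb : Matrix (Fin n) (Fin n) ℝ) (Xb : Matrix (Fin m) (Fin n) ℝ)
    (hR : Rb.IsSymm) (hY : Yb.IsSymm)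
    (hLMI : ∀ l : Fin M, (designLmiMatrix A B (νs l) ε h Pb Sb Rb Yb Xb).NegDefC)
    (ν : ℂ) (hν : ν ∈ convexHull ℝ (Set.range νs)) (z : Fin 3 × Fin n → ℂ) (hz : z ≠ 0) :
    (star z ⬝ᵥ (designLmiMatrix A B ν ε h Pb Sb Rb Yb Xb) *ᵥ z).re < 0 := by
  let S : Set ℂ := {μ | (star z ⬝ᵥ (designLmiMatrix A B μ ε h Pb Sb Rb Yb Xb) *ᵥ z).re < 0}
  have hsub : Set.range νs ⊆ S := by
    rintro _ ⟨l, rfl⟩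
    exact (hLMI l).2 z hz
  have hconv : Convex ℝ S := by
    intro x hx y hy s t hs ht hst
    simp only [S, Set.mem_setOf_eq] at hx hy ⊢
    rw [stk_surj z] at hx hy ⊢
    rw [design_form A B _ ε h Pb Sb Rb Yb Xb hR hY] at hx hy ⊢
    generalize (fun i => z (0, i)) = a at *
    generalize (fun i => z (1, i)) = b at *
    generalize (fun i => z (2, i)) = c at *
    simp only [rip, dotProduct_sub, dotProduct_smul, smul_eq_mul, Complex.sub_re, add_mul,
      Complex.add_re, Complex.real_smul, mul_assoc, Complex.re_ofReal_mul] at hx hy ⊢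
    have ht' : t = 1 - s := by linarith
    rcases hs.eq_or_lt with h0 | h0
    · subst h0
      have : t = 1 := by linarith
      subst this
      linarith
    · subst ht'
      nlinarith [mul_neg_of_pos_of_neg h0 hx, mul_nonpos_of_nonneg_of_nonpos ht hy.le]
  exact convexHull_min hsub hconv hν

lemma form_coercive {n m M : ℕ}
    (A : Matrix (Fin n) (Fin n) ℝ) (B : Matrix (Fin n) (Fin m) ℝ)
    (ε h : ℝ) (νs : Fin M → ℂ)
    (Pb Sb Rb Yb : Matrix (Fin n) (Fin n) ℝ) (Xb : Matrix (Fin m) (Fin n) ℝ)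
    (hR : Rb.IsSymm) (hY : Yb.IsSymm)
    (hLMI : ∀ l : Fin M, (designLmiMatrix A B (νs l) ε h Pb Sb Rb Yb Xb).NegDefC)
    (ν : ℂ) (hν : ν ∈ convexHull ℝ (Set.range νs)) :
    ∃ c : ℝ, 0 < c ∧ ∀ a b d : Fin n → ℂ,
      (star (stk a b d) ⬝ᵥ (designLmiMatrix A B ν ε h Pb Sb Rb Yb Xb) *ᵥ (stk a b d)).re
        ≤ -c * (nsq a + nsq b + nsq d) := by
  set M0 := designLmiMatrix A B ν ε h Pb Sb Rb Yb Xb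
  have hneg : ∀ z : Fin 3 × Fin n → ℂ, z ≠ 0 → (star z ⬝ᵥ M0 *ᵥ z).re < 0 :=
    form_neg_hull A B ε h νs Pb Sb Rb Yb Xb hR hY hLMI ν hν
  have hcont : Continuous fun z : Fin 3 × Fin n → ℂ => (star z ⬝ᵥ M0 *ᵥ z).re := by
    apply Complex.continuous_re.comp
    unfold dotProduct mulVec dotProduct
    simp only [Pi.star_apply]
    fun_prop
  obtain ⟨c0, hc0, hs⟩ : ∃ c0 : ℝ, 0 < c0 ∧ ∀ z ∈ Metric.sphere (0 : Fin 3 × Fin n → ℂ) 1,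
      (star z ⬝ᵥ M0 *ᵥ z).re ≤ -c0 := by
    rcases (Metric.sphere (0 : Fin 3 × Fin n → ℂ) 1).eq_empty_or_nonempty with he | hne
    · exact ⟨1, one_pos, by simp [he]⟩
    · obtain ⟨z0, hz0, hmax⟩ := (isCompact_sphere (0 : Fin 3 × Fin n → ℂ) 1).exists_isMaxOn hne
        hcont.continuousOn
      refine ⟨-(star z0 ⬝ᵥ M0 *ᵥ z0).re, ?_, fun z hz => ?_⟩
      · have : z0 ≠ 0 := by
          rintro rfl; simp at hz0
        linarith [hneg z0 this]
      · rw [neg_neg]; exact hmax hz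
  have hz : ∀ z : Fin 3 × Fin n → ℂ, (star z ⬝ᵥ M0 *ᵥ z).re ≤ -c0 * ‖z‖ ^ 2 := by
    intro z
    by_cases hz : z = 0
    · simp [hz]
    have hn : 0 < ‖z‖ := norm_pos_iff.2 hz
    have h1 := hs (‖z‖⁻¹ • z) (by simp [norm_smul, hn.ne'])
    have e : (star (‖z‖⁻¹ • z) ⬝ᵥ M0 *ᵥ (‖z‖⁻¹ • z)).re
        = ‖z‖⁻¹ * (‖z‖⁻¹ * (star z ⬝ᵥ M0 *ᵥ z).re) := by
      rw [star_smul, mulVec_smul, smul_dotProduct, dotProduct_smul]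
      simp
    rw [e] at h1
    have h2 := mul_le_mul_of_nonneg_left h1 (sq_nonneg ‖z‖)
    calc (star z ⬝ᵥ M0 *ᵥ z).re = ‖z‖ ^ 2 * (‖z‖⁻¹ * (‖z‖⁻¹ * (star z ⬝ᵥ M0 *ᵥ z).re)) := by
          field_simp
      _ ≤ _ := h2
      _ = _ := by ring
  refine ⟨c0 / (3 * n + 1), by positivity, fun a b d => (hz _).trans ?_⟩
  have hb : ∀ (v : Fin n → ℂ), (∀ i, ‖v i‖ ≤ ‖stk a b d‖) → nsq v ≤ n * ‖stk a b d‖ ^ 2 := by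
    intro v hv
    calc nsq v ≤ ∑ i : Fin n, ‖stk a b d‖ ^ 2 := by
          apply Finset.sum_le_sum
          intro i _
          rw [Complex.normSq_eq_norm_sq]
          exact pow_le_pow_left₀ (norm_nonneg _) (hv i) 2
      _ = _ := by simp
  have h1 := hb a (fun i => norm_le_pi_norm (stk a b d) (0, i))
  have h2 := hb b (fun i => norm_le_pi_norm (stk a b d) (1, i))
  have h3 := hb d (fun i => norm_le_pi_norm (stk a b d) (2, i))
  have h4 : nsq a + nsq b + nsq d ≤ (3 * n + 1) * ‖stk a b d‖ ^ 2 := by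
    nlinarith [sq_nonneg ‖stk a b d‖]
  have h5 : c0 / (3 * n + 1) * (nsq a + nsq b + nsq d) ≤ c0 * ‖stk a b d‖ ^ 2 := by
    calc _ ≤ c0 / (3 * n + 1) * ((3 * n + 1) * ‖stk a b d‖ ^ 2) := by gcongr
      _ = _ := by field_simp
  linarith

lemma hasDerivAt_primitive {f : ℝ → ℝ} (hf : Continuous f) (t : ℝ) :
    HasDerivAt (fun u => ∫ s in (0:ℝ)..u, f s) (f t) t :=
  (hf.integral_hasStrictDerivAt 0 t).hasDerivAt

lemma hasDerivAt_shift {E : Type*} [NormedAddCommGroup E] [NormedSpace ℝ E] {f : ℝ → E} {f' : E}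
    {t τ : ℝ} (hf : HasDerivAt f f' (t - τ)) :
    HasDerivAt (fun s => f (s - τ)) f' t := by
  exact HasDerivAt.comp_sub_const t τ hf

lemma qf_continuous {n : ℕ} (G : Matrix (Fin n) (Fin n) ℝ) {x y : ℝ → Fin n → ℂ}
    (hx : Continuous x) (hy : Continuous y) : Continuous fun s => qf G (x s) (y s) := by
  apply Complex.continuous_re.comp
  unfold dotProduct mulVec dotProduct
  simp only [Pi.star_apply]
  fun_prop

lemma nsq_continuous {n : ℕ} {x : ℝ → Fin n → ℂ} (hx : Continuous x) :
    Continuous fun s => nsq (x s) := by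
  unfold nsq
  simp only [Complex.normSq_apply]
  fun_prop

lemma jensen {n : ℕ} {R : Matrix (Fin n) (Fin n) ℝ} (hR : R.PosDef) {x x' : ℝ → Fin n → ℂ}
    (hx : ∀ t, HasDerivAt x (x' t) t) {Q : ℝ → ℝ} (hQ : ∀ t, HasDerivAt Q (qf R (x' t) (x' t)) t)
    {τ : ℝ} (hτ : 0 ≤ τ) (t : ℝ) :
    qf R (x t - x (t - τ)) (x t - x (t - τ)) ≤ τ * (Q t - Q (t - τ)) := by
  rcases hτ.eq_or_lt with h0 | h0
  · subst h0; simp [qf]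
  set d := x t - x (t - τ) with hd
  have hder : ∀ s, HasDerivAt (fun s => τ ^ 2 * Q s - 2 * τ * qf R d (x s) + s * qf R d d)
      (qf R (τ • x' s - d) (τ • x' s - d)) s := by
    intro s
    have h1 := ((hQ s).const_mul (τ ^ 2)).sub
      ((qf_hasDerivAt R (hasDerivAt_const s d) (hx s)).const_mul (2 * τ))
    have h2 := h1.add ((hasDerivAt_id s).mul_const (qf R d d))
    refine h2.congr_deriv ?_
    have hz : qf R (0 : Fin n → ℂ) (x s) = 0 := by simp [qf]
    simp only [qf_sub_left, qf_sub_right, qf_smul_left, qf_smul_right, hz,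
      qf_symm (posDef_isSymm hR) (x' s) d]
    ring
  have hm : Monotone (fun s => τ ^ 2 * Q s - 2 * τ * qf R d (x s) + s * qf R d d) :=
    monotone_of_hasDerivAt_nonneg hder (fun s => qf_nonneg hR _)
  have h := hm (show t - τ ≤ t by linarith)
  simp only at h
  have e : qf R d d = qf R d (x t) - qf R d (x (t - τ)) := by rw [← qf_sub_right]
  have : τ * qf R d d ≤ τ * (τ * (Q t - Q (t - τ))) := by nlinarith
  exact le_of_mul_le_mul_left this h0

lemma core {n m M : ℕ}
    (A : Matrix (Fin n) (Fin n) ℝ) (B : Matrix (Fin n) (Fin m) ℝ)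
    (ε h : ℝ) (νs : Fin M → ℂ)
    (Pb Sb Rb Yb : Matrix (Fin n) (Fin n) ℝ) (Xb : Matrix (Fin m) (Fin n) ℝ)
    (hP : Pb.PosDef) (hS : Sb.PosDef) (hR : Rb.PosDef) (hY : Yb.IsSymm)
    (hLMI : ∀ l : Fin M, (designLmiMatrix A B (νs l) ε h Pb Sb Rb Yb Xb).NegDefC)
    (ν : ℂ) (hν : ν ∈ convexHull ℝ (Set.range νs))
    (τ : ℝ) (hτ : τ ∈ Set.Icc 0 h) (x x' w : ℝ → Fin n → ℂ)
    (hx : ∀ t, HasDerivAt x (x' t) t) (hx' : Continuous x') (hw : Continuous w)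
    (heq : ∀ t, 0 ≤ t → Yb.map Complex.ofReal *ᵥ x' t = (A * Yb).map Complex.ofReal *ᵥ x t
          - ν • ((B * Xb).map Complex.ofReal *ᵥ x (t - τ)) - w t)
    (hwb : ∃ C, ∀ T, 0 ≤ T → ∫ s in (0:ℝ)..T, nsq (w s) ≤ C) :
    ∃ C, ∀ T, 0 ≤ T → ∫ s in (0:ℝ)..T, (nsq (x s) + nsq (x (s - τ)) + nsq (x' s)) ≤ C := by
  obtain ⟨c, hc, hco⟩ := form_coercive A B ε h νs Pb Sb Rb Yb Xb (posDef_isSymm hR) hY hLMI ν hν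
  obtain ⟨Cw, hCw⟩ := hwb
  have hxc : Continuous x := continuous_iff_continuousAt.2 fun t => (hx t).continuousAt
  have hxd : Continuous fun s => x (s - τ) := by fun_prop
  -- primitives
  set G : ℝ → ℝ := fun u => ∫ s in (0:ℝ)..u, qf Sb (x s) (x s) with hGdef
  have hG : ∀ t, HasDerivAt G (qf Sb (x t) (x t)) t :=
    hasDerivAt_primitive (qf_continuous Sb hxc hxc)
  set Q : ℝ → ℝ := fun u => ∫ s in (0:ℝ)..u, qf Rb (x' s) (x' s) with hQdef
  have hQ : ∀ t, HasDerivAt Q (qf Rb (x' t) (x' t)) t :=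
    hasDerivAt_primitive (qf_continuous Rb hx' hx')
  have hQc : Continuous Q := continuous_iff_continuousAt.2 fun t => (hQ t).continuousAt
  set QQ : ℝ → ℝ := fun u => ∫ s in (0:ℝ)..u, Q s with hQQdef
  have hQQ : ∀ t, HasDerivAt QQ (Q t) t := hasDerivAt_primitive hQc
  have hzc : Continuous fun s => nsq (x s) + nsq (x (s - τ)) + nsq (x' s) :=
    ((nsq_continuous hxc).add (nsq_continuous hxd)).add (nsq_continuous hx')
  have hZ := hasDerivAt_primitive hzc
  have hW := hasDerivAt_primitive (nsq_continuous hw)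
  set Z : ℝ → ℝ := fun u => ∫ s in (0:ℝ)..u, (nsq (x s) + nsq (x (s - τ)) + nsq (x' s)) with hZdef
  set W : ℝ → ℝ := fun u => ∫ s in (0:ℝ)..u, nsq (w s) with hWdef
  let V : ℝ → ℝ := fun t => qf Pb (x t) (x t) + (G t - G (t - τ))
    + τ * (τ * Q t - (QQ t - QQ (t - τ)))
  have hGm : Monotone G := monotone_of_hasDerivAt_nonneg hG fun s => qf_nonneg hS _
  have hQm : Monotone Q := monotone_of_hasDerivAt_nonneg hQ fun s => qf_nonneg hR _
  have hV0 : ∀ t, 0 ≤ V t := by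
    intro t
    have h1 := qf_nonneg hP (x t)
    have h2 := hGm (show t - τ ≤ t by linarith [hτ.1])
    have h3 : QQ t - QQ (t - τ) ≤ τ * Q t := by
      have hanti : MonotoneOn (fun s => s * Q t - QQ s) (Set.Iic t) := by
        apply monotoneOn_of_deriv_nonneg (convex_Iic t)
        · exact Continuous.continuousOn (by
            have : Continuous QQ := continuous_iff_continuousAt.2 fun t => (hQQ t).continuousAt
            fun_prop)
        · intro s _
          exact (((hasDerivAt_id s).mul_const (Q t)).sub (hQQ s)).differentiableAt.differentiableWithinAt
        · intro s hs
          rw [interior_Iic] at hs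
          have := (((hasDerivAt_id s).mul_const (Q t)).sub (hQQ s)).deriv
          simp only [id, one_mul] at this
          have h4 := hQm (le_of_lt hs)
          change 0 ≤ deriv ((fun y => y * Q t) - QQ) s
          rw [this]; linarith
      have := hanti (show t - τ ∈ Set.Iic t by simp [hτ.1]) (show t ∈ Set.Iic t by simp)
        (show t - τ ≤ t by linarith [hτ.1])
      simp only at this
      nlinarith
    have h5 : 0 ≤ τ * (τ * Q t - (QQ t - QQ (t - τ))) := mul_nonneg hτ.1 (by linarith)
    simp only [V]; linarith
  have hVd : ∀ t, HasDerivAt V (2 * qf Pb (x t) (x' t) + (qf Sb (x t) (x t)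
      - qf Sb (x (t - τ)) (x (t - τ))) + τ * (τ * qf Rb (x' t) (x' t) - (Q t - Q (t - τ)))) t := by
    intro t
    have h1 := ((qf_hasDerivAt Pb (hx t) (hx t)).add
      ((hG t).sub (hasDerivAt_shift (hG (t - τ))))).add
      ((((hQ t).const_mul τ).sub ((hQQ t).sub (hasDerivAt_shift (hQQ (t - τ))))).const_mul τ)
    refine h1.congr_deriv ?_
    rw [qf_symm (posDef_isSymm hP) (x' t) (x t)]
    ring
  -- Young constants
  set r : ℝ := c / (4 * (1 + ε ^ 2)) with hr
  have hrpos : 0 < r := by positivity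
  have hadd : ∀ a b : Fin n → ℂ, nsq (a + ε • b) ≤ 2 * (1 + ε ^ 2) * (nsq a + nsq b) := by
    intro a b
    unfold nsq
    rw [← Finset.sum_add_distrib, Finset.mul_sum]
    apply Finset.sum_le_sum
    intro i _
    simp only [Pi.add_apply, Pi.smul_apply, Complex.normSq_apply, Complex.add_re, Complex.add_im,
      Complex.real_smul, Complex.re_ofReal_mul, Complex.im_ofReal_mul]
    nlinarith [sq_nonneg ((a i).re - ε * (b i).re), sq_nonneg ((a i).im - ε * (b i).im),
      sq_nonneg (ε * (a i).re), sq_nonneg (ε * (a i).im), sq_nonneg (b i).re, sq_nonneg (b i).im]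
  have hVle : ∀ t, 0 ≤ t → 2 * qf Pb (x t) (x' t) + (qf Sb (x t) (x t)
      - qf Sb (x (t - τ)) (x (t - τ))) + τ * (τ * qf Rb (x' t) (x' t) - (Q t - Q (t - τ)))
      ≤ - (c / 2) * (nsq (x t) + nsq (x (t - τ)) + nsq (x' t)) + r⁻¹ * nsq (w t) := by
    intro t ht
    have h1 := hco (x t) (x (t - τ)) (x' t)
    rw [design_form A B ν ε h Pb Sb Rb Yb Xb (posDef_isSymm hR) hY, heq t ht, sub_sub_cancel] at h1
    have h2 := jensen hR hx hQ hτ.1 t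
    have h3 := (abs_le.1 (rip_young (x t + ε • x' t) (w t) hrpos)).1
    have h4 := mul_le_mul_of_nonneg_left (hadd (x t) (x' t)) hrpos.le
    have h5 : r * (2 * (1 + ε ^ 2) * (nsq (x t) + nsq (x' t))) =
        c / 2 * (nsq (x t) + nsq (x' t)) := by
      rw [hr]; field_simp; ring
    have h6 : τ * τ * qf Rb (x' t) (x' t) ≤ h ^ 2 * qf Rb (x' t) (x' t) := by
      apply mul_le_mul_of_nonneg_right _ (qf_nonneg hR _)
      nlinarith [hτ.1, hτ.2]
    have h7 := mul_nonneg hc.le (nsq_nonneg (x (t - τ)))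
    nlinarith
  have hanti : AntitoneOn (fun t => V t + c / 2 * Z t - r⁻¹ * W t) (Set.Ici 0) := by
    have hd : ∀ t, HasDerivAt (fun t => V t + c / 2 * Z t - r⁻¹ * W t) _ t := fun t =>
      (((hVd t).add ((hZ t).const_mul (c / 2))).sub ((hW t).const_mul r⁻¹))
    apply antitoneOn_of_deriv_nonpos (convex_Ici 0)
    · exact fun t _ => (hd t).continuousAt.continuousWithinAt
    · exact fun t _ => (hd t).differentiableAt.differentiableWithinAt
    · intro t ht
      rw [interior_Ici] at ht
      rw [(hd t).deriv]
      have := hVle t (le_of_lt ht)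
      linarith
  refine ⟨(V 0 + r⁻¹ * Cw) / (c / 2), fun T hT => ?_⟩
  have h1 := hanti (show (0:ℝ) ∈ Set.Ici 0 by simp) (show T ∈ Set.Ici 0 from hT) hT
  have hZ0 : Z 0 = 0 := by simp [hZdef]
  have hW0 : W 0 = 0 := by simp [hWdef]
  simp only [hZ0, hW0] at h1
  have h2 := mul_le_mul_of_nonneg_left (hCw T hT) (inv_pos.2 hrpos).le
  rw [le_div_iff₀ (by positivity)]
  have h3 := hV0 T
  change Z T * (c / 2) ≤ _
  change r⁻¹ * W T ≤ _ at h2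
  linarith

lemma tendsto_zero {n : ℕ} (τ : ℝ) (x x' : ℝ → Fin n → ℂ)
    (hx : ∀ t, HasDerivAt x (x' t) t) (hx' : Continuous x')
    (hb : ∃ C, ∀ T, 0 ≤ T → ∫ s in (0:ℝ)..T, (nsq (x s) + nsq (x (s - τ)) + nsq (x' s)) ≤ C) :
    Tendsto x atTop (nhds 0) := by
  obtain ⟨C, hC⟩ := hb
  have hxc : Continuous x := continuous_iff_continuousAt.2 fun t => (hx t).continuousAt
  have hxd : Continuous fun s => x (s - τ) := by fun_prop
  have hzc : Continuous fun s => nsq (x s) + nsq (x (s - τ)) + nsq (x' s) :=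
    ((nsq_continuous hxc).add (nsq_continuous hxd)).add (nsq_continuous hx')
  have hnn : ∀ s, 0 ≤ nsq (x s) + nsq (x (s - τ)) + nsq (x' s) := fun s =>
    add_nonneg (add_nonneg (nsq_nonneg _) (nsq_nonneg _)) (nsq_nonneg _)
  have hIntegrable : MeasureTheory.IntegrableOn
      (fun s => nsq (x s) + nsq (x (s - τ)) + nsq (x' s)) (Set.Ioi 0) := by
    apply MeasureTheory.integrableOn_Ioi_of_intervalIntegral_norm_bounded C 0
      (b := fun T : ℝ => T) (l := atTop) (fun T => ?_) tendsto_id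
    · filter_upwards [eventually_ge_atTop 0] with T hT
      simp only [Real.norm_of_nonneg (hnn _)]
      exact hC T hT
    · exact (hzc.integrableOn_Icc).mono_set Set.Ioc_subset_Icc_self
  have hid : ∀ a b : Fin n → ℂ, qf 1 a b = rip a b := by
    intro a b
    simp [qf, rip, Matrix.map_one]
  have hder : ∀ t, HasDerivAt (fun s => nsq (x s)) (2 * rip (x t) (x' t)) t := by
    intro t
    have h1 := qf_hasDerivAt (1 : Matrix (Fin n) (Fin n) ℝ) (hx t) (hx t)
    rw [qf_symm Matrix.isSymm_one (x' t) (x t)] at h1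
    simp only [hid, rip_self] at h1
    exact h1.congr_deriv (by ring)
  have hrc : Continuous fun t => 2 * rip (x t) (x' t) := by
    have := qf_continuous (1 : Matrix (Fin n) (Fin n) ℝ) hxc hx'
    simp only [hid] at this
    exact this.const_mul 2 
  have hg : Tendsto (fun s => nsq (x s)) atTop (nhds 0) := by
    apply MeasureTheory.tendsto_zero_of_hasDerivAt_of_integrableOn_Ioi (a := 0)
      (fun t _ => hder t)
    · refine hIntegrable.mono' hrc.aestronglyMeasurable (Eventually.of_forall fun t => ?_)
      have := rip_young (x t) (x' t) one_pos
      rw [Real.norm_eq_abs]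
      have h2 := nsq_nonneg (x (t - τ))
      simp only [one_mul, inv_one] at this
      linarith
    · refine hIntegrable.mono' (nsq_continuous hxc).aestronglyMeasurable (Eventually.of_forall fun t => ?_)
      rw [Real.norm_of_nonneg (nsq_nonneg _)]
      linarith [nsq_nonneg (x (t - τ)), nsq_nonneg (x' t)]
  rw [tendsto_pi_nhds]
  intro i
  rw [Pi.zero_apply]
  apply tendsto_zero_iff_norm_tendsto_zero.2
  have h1 : Tendsto (fun s => Real.sqrt (nsq (x s))) atTop (nhds 0) := by
    have := (Real.continuous_sqrt.tendsto 0).comp hg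
    rwa [Real.sqrt_zero] at this
  refine squeeze_zero (fun _ => norm_nonneg _) (fun s => ?_) h1
  apply Real.le_sqrt_of_sq_le
  rw [← Complex.normSq_eq_norm_sq]
  exact Finset.single_le_sum (f := fun i => Complex.normSq (x s i))
    (fun i _ => Complex.normSq_nonneg _) (Finset.mem_univ i)

lemma nsq_mulVec_le {n : ℕ} (G : Matrix (Fin n) (Fin n) ℂ) :
    ∃ C : ℝ, 0 ≤ C ∧ ∀ a : Fin n → ℂ, nsq (G *ᵥ a) ≤ C * nsq a := by
  refine ⟨∑ i, ∑ j, ‖G i j‖ ^ 2, by positivity, fun a => ?_⟩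
  unfold nsq
  simp only [Complex.normSq_eq_norm_sq]
  rw [Finset.sum_mul]
  apply Finset.sum_le_sum
  intro i _
  calc ‖(G *ᵥ a) i‖ ^ 2 ≤ (∑ j, ‖G i j‖ * ‖a j‖) ^ 2 := by
        apply pow_le_pow_left₀ (norm_nonneg _)
        have h1 : ‖∑ j, G i j * a j‖ ≤ ∑ j, ‖G i j * a j‖ := norm_sum_le _ _
        simp only [norm_mul] at h1
        exact h1
    _ ≤ _ := Finset.sum_mul_sq_le_sq_mul_sq _ _ _

/-- Contraction of the agent index with a complex vector. -/
noncomputable def ycon {N n : ℕ} (v : Fin N → ℂ) (d : Fin N × Fin n → ℝ) : Fin n → ℂ :=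
  fun j => ∑ i, v i * (d (i, j) : ℂ)

lemma ycon_sub {N n : ℕ} (v : Fin N → ℂ) (d e : Fin N × Fin n → ℝ) :
    ycon v (d - e) = ycon v d - ycon v e := by
  ext j; simp [ycon, mul_sub]

lemma ycon_add_left {N n : ℕ} (v u : Fin N → ℂ) (d : Fin N × Fin n → ℝ) :
    ycon (v + u) d = ycon v d + ycon u d := by
  ext j; simp [ycon, add_mul, Finset.sum_add_distrib]

lemma ycon_smul_left {N n : ℕ} (c : ℂ) (v : Fin N → ℂ) (d : Fin N × Fin n → ℝ) :
    ycon (c • v) d = c • ycon v d := by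
  ext j; simp [ycon, Finset.mul_sum, mul_assoc]

lemma ycon_kron {N n : ℕ} (F : Matrix (Fin N) (Fin N) ℝ) (G : Matrix (Fin n) (Fin n) ℝ)
    (v : Fin N → ℂ) (d : Fin N × Fin n → ℝ) :
    ycon v ((F ⊗ₖ G) *ᵥ d) =
      G.map Complex.ofReal *ᵥ ycon ((F.map Complex.ofReal)ᵀ *ᵥ v) d := by
  ext j
  simp only [ycon, mulVec, dotProduct, Fintype.sum_prod_type, kroneckerMap_apply, map_apply,
    transpose_apply, Complex.ofReal_sum, Complex.ofReal_mul, Finset.mul_sum, Finset.sum_mul]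
  rw [Finset.sum_comm]
  conv_rhs => rw [Finset.sum_comm]
  refine Finset.sum_congr rfl fun k _ => ?_
  rw [Finset.sum_comm]
  refine Finset.sum_congr rfl fun l _ => Finset.sum_congr rfl fun i _ => ?_
  ring

lemma ycon_hasDerivAt {N n : ℕ} (v : Fin N → ℂ) (G : Matrix (Fin n) (Fin n) ℂ)
    {δ : ℝ → Fin N × Fin n → ℝ} {δ' : Fin N × Fin n → ℝ}
    {t : ℝ} (h : HasDerivAt δ δ' t) :
    HasDerivAt (fun s => G *ᵥ ycon v (δ s)) (G *ᵥ ycon v δ') t := by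
  have h1 := hasDerivAt_pi.1 h
  rw [hasDerivAt_pi]
  intro j
  unfold mulVec dotProduct ycon
  apply HasDerivAt.fun_sum; intro k _
  apply HasDerivAt.const_mul
  apply HasDerivAt.fun_sum; intro i _
  apply HasDerivAt.const_mul
  exact (h1 (i, k)).ofReal_comp

lemma ycon_continuous {N n : ℕ} (v : Fin N → ℂ) (G : Matrix (Fin n) (Fin n) ℂ)
    {δ : ℝ → Fin N × Fin n → ℝ} (h : Continuous δ) :
    Continuous (fun s => G *ᵥ ycon v (δ s)) := by
  unfold mulVec dotProduct ycon
  fun_prop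

lemma spectrum_of_genEigen {N : ℕ} (F : Matrix (Fin N) (Fin N) ℂ) (μ : ℂ) (k : ℕ)
    (v : Fin N → ℂ) (hv : v ≠ 0)
    (h : ((Matrix.toLin' Fᵀ - μ • (1 : Module.End ℂ (Fin N → ℂ))) ^ k) v = 0) :
    μ ∈ spectrum ℂ F := by
  have h1 : Module.End.HasEigenvalue (Matrix.toLin' Fᵀ) μ := by
    apply Module.End.hasEigenvalue_of_hasGenEigenvalue (k := k)
    rw [Module.End.HasGenEigenvalue, Module.End.HasUnifEigenvalue]
    intro hb
    apply hv
    have : v ∈ Module.End.genEigenspace (Matrix.toLin' Fᵀ) μ k := by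
      rw [Module.End.mem_genEigenspace_nat]; exact h
    rw [hb] at this
    simpa using this
  have h2 := h1.mem_spectrum
  rw [Matrix.spectrum_toLin'] at h2
  rw [Matrix.mem_spectrum_iff_isRoot_charpoly] at h2 ⊢
  rwa [Matrix.charpoly_transpose] at h2

/-- **Direct state-feedback design for synchronization** (Theorem 8 of the paper).
If the design LMI (24) is feasible with common `P̄, S̄, R̄ ≻ 0`, symmetric invertible `Ȳ`
and `X̄` at every vertex `ν_l` of a convex hull containing all complex eigenvalues of `F`,
then the gain `K = X̄ Ȳ⁻¹` renders the global error dynamics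
`δ̇(t) = (I_N ⊗ A) δ(t) − (F ⊗ BK) δ(t−τ)` asymptotically stable for all `τ ∈ [0,h]`. -/
theorem direct_state_feedback_design {n m N M : ℕ}
    (A : Matrix (Fin n) (Fin n) ℝ) (B : Matrix (Fin n) (Fin m) ℝ)
    (F : Matrix (Fin N) (Fin N) ℝ) (ε h : ℝ) (hε : 0 < ε) (hh : 0 < h)
    (νs : Fin M → ℂ)
    (hspec : spectrum ℂ (F.map (Complex.ofReal)) ⊆ convexHull ℝ (Set.range νs))
    (Pb Sb Rb Yb : Matrix (Fin n) (Fin n) ℝ) (Xb : Matrix (Fin m) (Fin n) ℝ)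
    (hP : Pb.PosDef) (hS : Sb.PosDef) (hR : Rb.PosDef)
    (hY : Yb.IsSymm) (hYinv : IsUnit Yb)
    (hLMI : ∀ l : Fin M, (designLmiMatrix A B (νs l) ε h Pb Sb Rb Yb Xb).NegDefC)
    (K : Matrix (Fin m) (Fin n) ℝ) (hK : K = Xb * Yb⁻¹) :
    ∀ τ : ℝ, τ ∈ Set.Icc 0 h →
      ∀ δ : ℝ → (Fin N × Fin n → ℝ), ContDiff ℝ 1 δ →
        (∀ t : ℝ, 0 ≤ t → HasDerivAt δ
          (((1 : Matrix (Fin N) (Fin N) ℝ) ⊗ₖ A).mulVec (δ t)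
            - (F ⊗ₖ (B * K)).mulVec (δ (t - τ))) t) →
        Tendsto δ atTop (nhds 0) := by
  intro τ hτ δ hδ hode
  set Yi : Matrix (Fin n) (Fin n) ℂ := (Yb⁻¹).map Complex.ofReal with hYi
  have mm : ∀ {p q r : ℕ} (U : Matrix (Fin p) (Fin q) ℝ) (V : Matrix (Fin q) (Fin r) ℝ),
      U.map Complex.ofReal * V.map Complex.ofReal = (U * V).map Complex.ofReal := by
    intro p q r U V
    exact (Matrix.map_mul (f := Complex.ofRealHom)).symm
  have hdet : IsUnit Yb.det := (Matrix.isUnit_iff_isUnit_det Yb).1 hYinv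
  have hYY : Yb.map Complex.ofReal * Yi = 1 := by
    rw [hYi, mm, Matrix.mul_nonsing_inv _ hdet]
    simp [Matrix.map_one]
  have hAY : (A * Yb).map Complex.ofReal * Yi = A.map Complex.ofReal := by
    rw [hYi, mm, mul_assoc, Matrix.mul_nonsing_inv _ hdet, mul_one]
  have hBX : (B * Xb).map Complex.ofReal * Yi = (B * K).map Complex.ofReal := by
    rw [hYi, mm, hK, Matrix.mul_assoc]
  set f : Module.End ℂ (Fin N → ℂ) := Matrix.toLin' (F.map Complex.ofReal)ᵀ with hf
  have hδd : ∀ t, HasDerivAt δ (deriv δ t) t := fun t =>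
    (hδ.differentiable one_ne_zero t).hasDerivAt
  have hδ'c : Continuous (deriv δ) := hδ.continuous_deriv le_rfl
  have hδc : Continuous δ := hδ.continuous
  have hx : ∀ v t, HasDerivAt (fun s => Yi *ᵥ ycon v (δ s)) (Yi *ᵥ ycon v (deriv δ t)) t :=
    fun v t => ycon_hasDerivAt v Yi (hδd t)
  have hx' : ∀ v, Continuous (fun s => Yi *ᵥ ycon v (deriv δ s)) :=
    fun v => ycon_continuous v Yi hδ'c
  have hfv : ∀ v, (F.map Complex.ofReal)ᵀ *ᵥ v = f v := fun v => by simp [hf]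
  -- L² bounds on generalized eigenvectors
  have good : ∀ (μ : ℂ) (k : ℕ) (v : Fin N → ℂ),
      ((f - μ • (1 : Module.End ℂ (Fin N → ℂ))) ^ k) v = 0 →
      ∃ C, ∀ T, 0 ≤ T → ∫ s in (0:ℝ)..T, (nsq (Yi *ᵥ ycon v (δ s))
        + nsq (Yi *ᵥ ycon v (δ (s - τ))) + nsq (Yi *ᵥ ycon v (deriv δ s))) ≤ C := by
    intro μ k
    induction k with
    | zero =>
      intro v hv
      have hv0 : v = 0 := by simpa using hv
      refine ⟨0, fun T _ => ?_⟩
      have : ∀ d : Fin N × Fin n → ℝ, nsq (Yi *ᵥ ycon v d) = 0 := by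
        intro d
        have : ycon v d = 0 := by ext j; simp [ycon, hv0]
        simp [this, nsq]
      simp [this]
    | succ k ih =>
      intro v hv
      by_cases hv0 : v = 0
      · exact ih v (by simp [hv0])
      have hμ := hspec (spectrum_of_genEigen _ μ (k + 1) v hv0 hv)
      set u := f v - μ • v with hu
      have hu0 : ((f - μ • (1 : Module.End ℂ (Fin N → ℂ))) ^ k) u = 0 := by
        rw [pow_succ] at hv
        simpa [hu] using hv
      obtain ⟨C, hC⟩ := ih u hu0
      have hwc : Continuous fun s => (B * Xb).map Complex.ofReal *ᵥ
          (Yi *ᵥ ycon u (δ (s - τ))) := by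
        simp only [mulVec_mulVec]
        exact ycon_continuous u _ (δ := fun s => δ (s - τ)) (by fun_prop)
      refine core A B ε h νs Pb Sb Rb Yb Xb hP hS hR hY hLMI μ hμ τ hτ
        (fun s => Yi *ᵥ ycon v (δ s)) (fun s => Yi *ᵥ ycon v (deriv δ s))
        (fun s => (B * Xb).map Complex.ofReal *ᵥ (Yi *ᵥ ycon u (δ (s - τ))))
        (hx v) (hx' v) hwc ?_ ?_
      · intro t ht
        simp only [mulVec_mulVec, hYY, hAY, hBX, one_mulVec]
        rw [(hode t ht).deriv, ycon_sub, ycon_kron, ycon_kron, hfv]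
        have e1 : ((1 : Matrix (Fin N) (Fin N) ℝ).map Complex.ofReal)ᵀ *ᵥ v = v := by
          simp [Matrix.map_one]
        have e2 : f v = μ • v + u := by rw [hu]; abel
        rw [e1, e2, ycon_add_left, ycon_smul_left, mulVec_add, mulVec_smul]
        abel
      · obtain ⟨D, hD, hDle⟩ := nsq_mulVec_le ((B * Xb).map Complex.ofReal)
        refine ⟨D * C, fun T hT => ?_⟩
        have hc1 : Continuous fun s => (nsq (Yi *ᵥ ycon u (δ s))
            + nsq (Yi *ᵥ ycon u (δ (s - τ))) + nsq (Yi *ᵥ ycon u (deriv δ s))) :=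
          ((nsq_continuous (ycon_continuous u _ hδc)).add
            (nsq_continuous (ycon_continuous u _ (δ := fun s => δ (s - τ)) (by fun_prop)))).add
            (nsq_continuous (hx' u))
        calc _ ≤ ∫ s in (0:ℝ)..T, D * (nsq (Yi *ᵥ ycon u (δ s))
              + nsq (Yi *ᵥ ycon u (δ (s - τ))) + nsq (Yi *ᵥ ycon u (deriv δ s))) := by
              apply intervalIntegral.integral_mono_on hT
                ((nsq_continuous hwc).intervalIntegrable _ _)
                ((hc1.const_mul D).intervalIntegrable _ _)
              intro s _
              refine (hDle _).trans ?_
              apply mul_le_mul_of_nonneg_left _ hD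
              linarith [nsq_nonneg (Yi *ᵥ ycon u (δ s)), nsq_nonneg (Yi *ᵥ ycon u (deriv δ s))]
          _ = D * _ := intervalIntegral.integral_const_mul _ _
          _ ≤ D * C := mul_le_mul_of_nonneg_left (hC T hT) hD
  have htend : ∀ v : Fin N → ℂ, Tendsto (fun s => Yi *ᵥ ycon v (δ s)) atTop (nhds 0) := by
    intro v
    have hv : v ∈ ⨆ μ : ℂ, f.maxGenEigenspace μ := by
      rw [Module.End.iSup_maxGenEigenspace_eq_top]; trivial
    induction hv using Submodule.iSup_induction' with
    | mem μ v hv =>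
      obtain ⟨k, hk⟩ := (Module.End.mem_maxGenEigenspace _ _ _).1 hv
      exact tendsto_zero τ _ _ (hx v) (hx' v) (good μ k v hk)
    | zero =>
      have : ∀ d : Fin N × Fin n → ℝ, Yi *ᵥ ycon (0 : Fin N → ℂ) d = 0 := by
        intro d
        have : ycon (0 : Fin N → ℂ) d = 0 := by ext j; simp [ycon]
        simp [this]
      simp [this]
    | add a b _ _ ha hb =>
      simp only [ycon_add_left, mulVec_add]
      simpa using ha.add hb
  rw [tendsto_pi_nhds]
  rintro ⟨i, j⟩
  have h1 := htend (Pi.single i 1)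
  have h2 : Tendsto (fun s => Yb.map Complex.ofReal *ᵥ (Yi *ᵥ ycon (Pi.single i 1) (δ s))) atTop
      (nhds (Yb.map Complex.ofReal *ᵥ 0)) := by
    have hc : Continuous fun a : Fin n → ℂ => Yb.map Complex.ofReal *ᵥ a := by
      unfold mulVec dotProduct; fun_prop
    exact (hc.tendsto 0).comp h1
  simp only [mulVec_mulVec, hYY, one_mulVec, mulVec_zero] at h2
  have h3 := (Complex.continuous_re.tendsto _).comp ((tendsto_pi_nhds.1 h2) j)
  simpa [ycon, Function.comp_def, Pi.single_apply] using h3
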